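/- Let m ≥ 6 be an integer and let G be the graph obtained from the path P_m = u₁u₂⋯u_m by adding the two edges u₁u₃ and u_{m−2}u_m (i.e., G is obtained from a path by identifying each of its two end vertices with a vertex of a triangle). Then for every connected simple graph H of order n, p(G □ H) ≤ mn/2. -/

import Mathlib

open SimpleGraph

/-- `P` is a path decomposition of `G`: a list of edge-disjoint paths of `G`
covering all the edges of `G`. -/
def SimpleGraph.IsPathDecomp {V : Type*} (G : SimpleGraph V)
    (P : List (Σ u v : V, G.Walk u v)) : Prop :=
  (∀ p ∈ P, p.2.2.IsPath) ∧
  P.Pairwise (fun p q => ∀ e ∈ p.2.2.edges, e ∉ q.2.2.edges) ∧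
  ∀ e ∈ G.edgeSet, ∃ p ∈ P, e ∈ p.2.2.edges

/-- `p(G)`: the minimum number of paths in a path decomposition of `G`. -/
noncomputable def SimpleGraph.pathNumber {V : Type*} (G : SimpleGraph V) : ℕ :=
  sInf {k | ∃ P, G.IsPathDecomp P ∧ P.length = k}

/-- The multiset of edges traversed by a list of vertices. -/
def pathEdges {V : Type*} : List V → Multiset (Sym2 V)
  | a :: b :: l => s(a, b) ::ₘ pathEdges (b :: l)
  | _ => 0

/-- The two ends of a list of vertices. -/
def pathEnds {V : Type*} (l : List V) : Multiset (Option V) := {l.head?, l.getLast?}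

/-- `M` is a multiset of duplicate-free lists with edge multiset `E`
and multiset of ends `T`. -/
structure IsDec {V : Type*} (M : Multiset (List V)) (E : Multiset (Sym2 V))
    (T : Multiset V) : Prop where
  nodup : ∀ l ∈ M, l.Nodup
  edges : M.bind pathEdges = E
  ends : M.bind pathEnds = T.map some

section Basic
open scoped Classical
variable {V : Type*}

@[simp] lemma pathEdges_nil : pathEdges ([] : List V) = 0 := rfl
@[simp] lemma pathEdges_singleton (a : V) : pathEdges [a] = 0 := rfl
@[simp] lemma pathEdges_cons_cons (a b : V) (l : List V) :
    pathEdges (a :: b :: l) = s(a, b) ::ₘ pathEdges (b :: l) := rfl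

lemma pathEdges_append (l₁ l₂ : List V) (x y : V) :
    pathEdges (l₁ ++ x :: y :: l₂) =
      pathEdges (l₁ ++ [x]) + s(x, y) ::ₘ pathEdges (y :: l₂) := by
  induction l₁ with
  | nil => simp
  | cons a l ih =>
    cases l with
    | nil => simp [Multiset.cons_swap]
    | cons b l =>
      simp only [List.cons_append, pathEdges_cons_cons] at ih ⊢
      rw [ih, Multiset.cons_add]

lemma pathEdges_reverse (l : List V) : pathEdges l.reverse = pathEdges l := by
  induction l with
  | nil => rfl
  | cons a l ih =>
    cases l with
    | nil => rfl
    | cons b l =>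
      have := pathEdges_append l.reverse [] b a
      simp only [List.reverse_cons, List.append_assoc, List.cons_append,
        List.nil_append] at this ih ⊢
      rw [this, ih]
      simp [Sym2.eq_swap, add_comm, ← Multiset.singleton_add]

lemma pathEnds_reverse (l : List V) : pathEnds l.reverse = pathEnds l := by
  simpa [pathEnds] using Multiset.pair_comm _ _

lemma pathEdges_map {W : Type*} (f : V → W) (l : List V) :
    pathEdges (l.map f) = (pathEdges l).map (Sym2.map f) := by
  induction l with
  | nil => rfl
  | cons a l ih =>
    cases l with
    | nil => rfl
    | cons b l => simpa using ih

lemma mem_of_mem_pathEdges {l : List V} {a b : V} (h : s(a, b) ∈ pathEdges l) :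
    a ∈ l ∧ b ∈ l := by
  induction l with
  | nil => simp at h
  | cons x l ih =>
    cases l with
    | nil => simp at h
    | cons y l =>
      simp only [pathEdges_cons_cons, Multiset.mem_cons] at h
      rcases h with h | h
      · rw [Sym2.eq_iff] at h
        rcases h with ⟨rfl, rfl⟩ | ⟨rfl, rfl⟩ <;> simp
      · have := ih h
        exact ⟨List.mem_cons_of_mem _ this.1, List.mem_cons_of_mem _ this.2⟩

lemma not_isDiag_of_mem_pathEdges {l : List V} (hl : l.Nodup) {e : Sym2 V}
    (he : e ∈ pathEdges l) : ¬ e.IsDiag := by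
  induction l with
  | nil => simp at he
  | cons x l ih =>
    cases l with
    | nil => simp at he
    | cons y l =>
      simp only [pathEdges_cons_cons, Multiset.mem_cons] at he
      rcases he with rfl | he
      · simp only [List.nodup_cons, List.mem_cons, not_or] at hl
        simpa using hl.1.1
      · exact ih hl.of_cons he

lemma IsDec.not_isDiag {M : Multiset (List V)} {E : Multiset (Sym2 V)} {T : Multiset V}
    (h : IsDec M E T) {e : Sym2 V} (he : e ∈ E) : ¬ e.IsDiag := by
  rw [← h.edges, Multiset.mem_bind] at he
  obtain ⟨l, hl, he⟩ := he
  exact not_isDiag_of_mem_pathEdges (h.nodup l hl) he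

lemma IsDec.exists_cons {M : Multiset (List V)} {E : Multiset (Sym2 V)} {T : Multiset V}
    (h : IsDec M E T) {p : List V} (hp : p ∈ M ∨ p.reverse ∈ M) :
    ∃ M₁, IsDec (p ::ₘ M₁) E T ∧ (M = p ::ₘ M₁ ∨ M = p.reverse ::ₘ M₁) := by
  rcases hp with hp | hp
  · obtain ⟨M₁, rfl⟩ := Multiset.exists_cons_of_mem hp
    exact ⟨M₁, h, Or.inl rfl⟩
  · obtain ⟨M₁, rfl⟩ := Multiset.exists_cons_of_mem hp
    refine ⟨M₁, ⟨?_, ?_, ?_⟩, Or.inr rfl⟩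
    · intro l hl
      rcases Multiset.mem_cons.1 hl with rfl | hl
      · exact List.nodup_reverse.1 (h.nodup _ (Multiset.mem_cons_self _ _))
      · exact h.nodup l (Multiset.mem_cons_of_mem hl)
    · simpa [pathEdges_reverse] using h.edges
    · simpa [pathEnds_reverse] using h.ends

lemma IsDec.exists_head {M : Multiset (List V)} {E : Multiset (Sym2 V)} {T : Multiset V}
    (h : IsDec M E T) {v : V} (hv : v ∈ T) :
    ∃ l, v :: l ∈ M ∨ (v :: l).reverse ∈ M := by
  have : some v ∈ M.bind pathEnds := by rw [h.ends]; exact Multiset.mem_map_of_mem _ hv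
  obtain ⟨p, hp, hv⟩ := Multiset.mem_bind.1 this
  simp only [pathEnds, Multiset.insert_eq_cons, Multiset.mem_cons,
    Multiset.mem_singleton] at hv
  rcases hv with hv | hv
  · obtain ⟨l, rfl⟩ := List.head?_eq_some_iff.1 hv.symm
    exact ⟨l, Or.inl hp⟩
  · rw [← List.head?_reverse] at hv
    obtain ⟨l, hl⟩ := List.head?_eq_some_iff.1 hv.symm
    exact ⟨l, Or.inr (by rw [← hl]; simpa using hp)⟩

/-- Moving an end of a decomposition from `b` to `a` while adding the edge `ab`, by rotations
that never return to `Z`. -/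
lemma IsDec.move_end_aux (a : V) (n : ℕ) :
    ∀ (M : Multiset (List V)) (E : Multiset (Sym2 V)) (T : Multiset V) (b : V) (Z : Set V),
      IsDec M E (b ::ₘ T) → E.Nodup → a ≠ b → s(a, b) ∉ E →
      (∀ z, (z = b ∨ z ∉ Z ∧ s(a, z) ∈ E) → ∃ l, ((z :: l) ∈ M ∨ (z :: l).reverse ∈ M) ∧
        ∀ l₁ y l₂, z :: l = l₁ ++ y :: a :: l₂ → y ∉ Z) →
      (E.filter (fun e => ∃ z, z ∉ Z ∧ e = s(a, z))).card < n →
      ∃ M', IsDec M' (s(a, b) ::ₘ E) (a ::ₘ T) := by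
  induction n with
  | zero => intro M E T b Z _ _ _ _ _ hn; exact absurd hn (Nat.not_lt_zero _)
  | succ n ih =>
    intro M E T b Z hM hE hab habE hZ hn
    obtain ⟨l, hl, hlZ⟩ := hZ b (Or.inl rfl)
    obtain ⟨M₁, hM₁, hMM₁⟩ := hM.exists_cons hl
    have hends := hM₁.ends
    have hedges := hM₁.edges
    have hnd := hM₁.nodup (b :: l) (Multiset.mem_cons_self _ _)
    have hnd₁ : ∀ q ∈ M₁, q.Nodup := fun q hq => hM₁.nodup q (Multiset.mem_cons_of_mem hq)
    have htok : ∀ q, q ∈ M ∨ q.reverse ∈ M →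
        (q = b :: l ∨ q = (b :: l).reverse) ∨ (q ∈ M₁ ∨ q.reverse ∈ M₁) := by
      intro q hq
      have hr : ∀ p : List V, q.reverse = p ↔ q = p.reverse := fun p => List.reverse_eq_iff
      rcases hMM₁ with rfl | rfl <;> simp only [Multiset.mem_cons, hr, List.reverse_reverse] at hq
        <;> tauto
    by_cases hal : a ∈ b :: l
    · obtain ⟨l₁, l₂, hl₁₂⟩ := List.append_of_mem hal
      obtain ⟨l₀, rfl⟩ : ∃ l₀, l₁ = b :: l₀ := by
        cases l₁ with
        | nil =>
          simp only [List.nil_append, List.cons.injEq] at hl₁₂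
          exact absurd hl₁₂.1.symm hab
        | cons c l₀ =>
          simp only [List.cons_append, List.cons.injEq] at hl₁₂
          exact ⟨l₀, by rw [hl₁₂.1]⟩
      obtain ⟨l', z, hl'⟩ : ∃ l' z, b :: l₀ = l' ++ [z] :=
        ⟨(b :: l₀).dropLast, _, (List.dropLast_append_getLast (List.cons_ne_nil _ _)).symm⟩
      have hp : b :: l = l' ++ z :: a :: l₂ := by rw [hl₁₂, hl']; simp
      have hzZ : z ∉ Z := hlZ _ _ _ hp
      have hrev : l₀.reverse ++ [b] = z :: l'.reverse := by
        have := congrArg List.reverse hl'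
        simpa using this
      set p' := z :: (l'.reverse ++ a :: l₂) with hp'
      have hp'2 : p' = l₀.reverse ++ b :: a :: l₂ := by
        have : p' = (l₀.reverse ++ [b]) ++ a :: l₂ := by rw [hrev]; simp [hp']
        rw [this]; simp
      have hperm : List.Perm p' (b :: l) := by
        rw [hp, hp']
        refine List.Perm.trans ?_ List.perm_middle.symm
        exact List.Perm.cons _ (List.Perm.append (List.reverse_perm _) (List.Perm.refl _))
      have he1 : pathEdges (b :: l) = s(a, z) ::ₘ (pathEdges (b :: l₀) + pathEdges (a :: l₂)) := by
        rw [hp, pathEdges_append, ← hl', Multiset.add_cons, Sym2.eq_swap]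
      have he2 : pathEdges p' = s(a, b) ::ₘ (pathEdges (b :: l₀) + pathEdges (a :: l₂)) := by
        rw [hp'2, pathEdges_append, ← List.reverse_cons, pathEdges_reverse, Multiset.add_cons,
          Sym2.eq_swap]
      have hlast : p'.getLast? = (b :: l).getLast? := by
        have : p' = (z :: l'.reverse) ++ a :: l₂ := by simp [hp']
        rw [hl₁₂, this, List.getLast?_append, List.getLast?_append, List.getLast?_cons,
          Option.some_or, Option.some_or]
      rw [Multiset.cons_bind, he1, Multiset.cons_add] at hedges
      set E' := pathEdges (b :: l₀) + pathEdges (a :: l₂) + M₁.bind pathEdges with hE'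
      rw [← hedges] at hE habE hn hZ ⊢
      rw [Multiset.nodup_cons] at hE
      rw [Multiset.mem_cons, not_or] at habE
      have hzb : z ≠ b := fun h => habE.1 (by rw [h])
      have haz : a ≠ z := by
        intro h
        refine hM.not_isDiag (e := s(a, z)) (by rw [← hedges]; simp) (by simpa using h)
      have hdec : IsDec (p' ::ₘ M₁) (s(a, b) ::ₘ E') (z ::ₘ T) := by
        refine ⟨?_, ?_, ?_⟩
        · intro q hq
          rcases Multiset.mem_cons.1 hq with rfl | hq
          · exact hperm.nodup_iff.2 hnd
          · exact hnd₁ q hq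
        · rw [Multiset.cons_bind, he2, Multiset.cons_add]
        · rw [Multiset.cons_bind] at hends ⊢
          simp only [pathEnds, Multiset.insert_eq_cons, hlast, Multiset.map_cons,
            Multiset.cons_add, List.head?_cons, Multiset.cons_inj_right] at hends ⊢
          simpa [hp'] using hends
      rw [Multiset.cons_swap]
      refine ih (p' ::ₘ M₁) (s(a, b) ::ₘ E') T z (insert b Z) hdec
        (Multiset.nodup_cons.2 ⟨habE.2, hE.2⟩) haz
        (by
          rw [Multiset.mem_cons, not_or]
          exact ⟨fun h => habE.1 h.symm, hE.1⟩) ?_ ?_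
      · intro w hw
        have hw' : w ∉ Z ∧ s(a, w) ∈ s(a, z) ::ₘ E' ∧ w ≠ b := by
          rcases hw with rfl | ⟨hw, hwE⟩
          · exact ⟨hzZ, by simp, hzb⟩
          · rw [Set.mem_insert_iff, not_or] at hw
            refine ⟨hw.2, Multiset.mem_cons_of_mem ?_, hw.1⟩
            rcases Multiset.mem_cons.1 hwE with h | h
            · exact absurd (Sym2.congr_right.1 h) hw.1
            · exact h
        have haw : w ≠ a := by
          rintro rfl
          exact hM.not_isDiag (e := s(w, w)) (by rw [← hedges]; exact hw'.2.1) (by simp)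
        obtain ⟨q, hq, hqZ⟩ := hZ w (Or.inr ⟨hw'.1, hw'.2.1⟩)
        rcases htok _ hq with (h | h) | h
        · simp only [List.cons.injEq] at h; exact absurd h.1 hw'.2.2
        · obtain ⟨q', hq'⟩ : ∃ q', p'.reverse = w :: q' := by
            rw [hp] at h
            have h2 : p'.reverse = l₂.reverse ++ a :: (l' ++ [z]) := by simp [hp']
            have h3 : w :: q = l₂.reverse ++ a :: z :: l'.reverse := by rw [h]; simp
            rw [h2]
            cases hl2 : l₂.reverse with
            | nil => rw [hl2] at h3; simp at h3; exact absurd h3.1 haw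
            | cons x t => rw [hl2] at h3; simp at h3; rw [h3.1]; exact ⟨_, rfl⟩
          refine ⟨q', Or.inr (by rw [← hq']; simp), ?_⟩
          intro m₁ y m₂ hm
          have h2 : p'.reverse = l₂.reverse ++ a :: (l' ++ [z]) := by simp [hp']
          have h3 : w :: q = l₂.reverse ++ a :: z :: l'.reverse := by rw [h, hp]; simp
          have hnd2 : (l₂.reverse ++ a :: (l' ++ [z])).Nodup := by
            rw [← h2, List.nodup_reverse]
            exact hperm.nodup_iff.2 hnd
          have hm2 : l₂.reverse ++ a :: (l' ++ [z]) = (m₁ ++ [y]) ++ a :: m₂ := by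
            rw [← h2, hq', hm]; simp
          have ha1 : a ∉ l₂.reverse := fun hh =>
            (List.nodup_append.1 hnd2).2.2 a hh a (List.mem_cons_self) rfl
          have ha2 : a ∉ l' ++ [z] := (List.nodup_cons.1 (List.nodup_append.1 hnd2).2.1).1
          have hl2 := (List.append_cons_inj_of_notMem ha1 ha2).1 hm2
          rw [Set.mem_insert_iff, not_or]
          refine ⟨?_, hqZ m₁ y (z :: l'.reverse) (by rw [h3, hl2.1]; simp)⟩
          rintro rfl
          refine (List.nodup_append.1 hnd2).2.2 y (by rw [hl2.1]; simp) y ?_ rfl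
          rw [← hl']; simp
        · refine ⟨q, ?_, ?_⟩
          · exact h.imp (Multiset.mem_cons_of_mem) (Multiset.mem_cons_of_mem)
          · intro m₁ y m₂ hm
            rw [Set.mem_insert_iff, not_or]
            refine ⟨?_, hqZ m₁ y m₂ hm⟩
            rintro rfl
            refine habE.2 (Multiset.mem_add.2 (Or.inr ?_))
            have hmem : s(a, y) ∈ pathEdges (w :: q) := by
              rw [hm, pathEdges_append, Sym2.eq_swap]; simp
            rcases h with h | h
            · exact Multiset.mem_bind.2 ⟨_, h, hmem⟩
            · exact Multiset.mem_bind.2 ⟨_, h, by rwa [pathEdges_reverse]⟩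
      · refine lt_of_lt_of_le ?_ (Nat.lt_succ_iff.1 hn)
        rw [Multiset.filter_cons_of_neg, Multiset.filter_cons_of_pos _ ⟨z, hzZ, rfl⟩,
          Multiset.card_cons, Nat.lt_succ_iff]
        · refine Multiset.card_le_card (Multiset.monotone_filter_right _ ?_)
          rintro e ⟨x, hx, rfl⟩
          exact ⟨x, fun h => hx (Set.mem_insert_of_mem _ h), rfl⟩
        · rintro ⟨x, hx, h⟩
          exact hx (by rw [← Sym2.congr_right.1 h]; exact Set.mem_insert _ _)
    · refine ⟨(a :: b :: l) ::ₘ M₁, ?_, ?_, ?_⟩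
      · intro q hq
        rcases Multiset.mem_cons.1 hq with rfl | hq
        · exact List.nodup_cons.2 ⟨hal, hnd⟩
        · exact hnd₁ q hq
      · rw [← hedges]; simp
      · rw [Multiset.cons_bind] at hends ⊢
        simp only [pathEnds, Multiset.insert_eq_cons, Multiset.map_cons,
          Multiset.cons_add, List.head?_cons, Multiset.cons_inj_right] at hends ⊢
        simpa using hends

end Basic

section Gallai
open scoped Classical
variable {V : Type*}

/-- If every neighbour of `a` is an end of the decomposition, then adding the edge `ab` allows
to move one end from `b` to `a`. -/
lemma IsDec.move_end {M : Multiset (List V)} {E : Multiset (Sym2 V)} {T : Multiset V} {a b : V}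
    (hM : IsDec M E (b ::ₘ T)) (hE : E.Nodup) (hab : a ≠ b) (habE : s(a, b) ∉ E)
    (hT : ∀ z, s(a, z) ∈ E → z ∈ b ::ₘ T) : ∃ M', IsDec M' (s(a, b) ::ₘ E) (a ::ₘ T) := by
  refine IsDec.move_end_aux a _ M E T b ∅ hM hE hab habE ?_ (Nat.lt_succ_self _)
  intro z hz
  obtain ⟨l, hl⟩ := hM.exists_head (v := z) (by
    rcases hz with rfl | hz
    · exact Multiset.mem_cons_self _ _
    · exact hT z hz.2)
  exact ⟨l, hl, fun _ _ _ _ => Set.notMem_empty _⟩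

lemma IsDec.move_end_along {x : V} {T : Multiset V} (hT : ∀ v, v ≠ x → v ∈ T) (l : List V) :
    ∀ (u : V) (M : Multiset (List V)) (F : Multiset (Sym2 V)), IsDec M F (u ::ₘ T) →
      (u :: l).Nodup → (pathEdges (u :: l) + F).Nodup → x ∉ l → (∀ w ∈ l, s(w, x) ∉ F) →
      ∃ M', IsDec M' (pathEdges (u :: l) + F) ((u :: l).getLast (List.cons_ne_nil _ _) ::ₘ T) := by
  induction l with
  | nil => intro u M F hM _ _ _ _; exact ⟨M, by simpa using hM⟩
  | cons y l ih =>
    intro u M F hM hl hF hx hlx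
    simp only [pathEdges_cons_cons, Multiset.cons_add, Multiset.nodup_cons,
      Multiset.mem_add, not_or] at hF
    have hF' := (Multiset.nodup_add.1 hF.2)
    have huy : y ≠ u := by rintro rfl; simp at hl
    obtain ⟨M', hM'⟩ := hM.move_end (a := y) hF'.2.1 huy
      (by rw [Sym2.eq_swap]; exact hF.1.2)
      (fun z hz => Multiset.mem_cons_of_mem (hT z (by
        rintro rfl
        exact hlx y (by simp) hz)))
    obtain ⟨M'', hM''⟩ := ih y M' _ hM' hl.of_cons
      (by
        rw [Multiset.add_cons, Multiset.nodup_cons, Sym2.eq_swap]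
        exact ⟨by simpa using hF.1, hF.2⟩)
      (fun h => hx (List.mem_cons_of_mem _ h))
      (by
        intro w hw
        rw [Multiset.mem_cons, not_or]
        refine ⟨?_, hlx w (List.mem_cons_of_mem _ hw)⟩
        intro h
        rw [Sym2.eq_iff] at h
        simp only [List.nodup_cons, List.mem_cons, not_or] at hl
        rcases h with ⟨rfl, _⟩ | ⟨rfl, _⟩
        · exact hl.2.1 hw
        · exact hl.1.2 hw)
    refine ⟨M'', ?_⟩
    rw [Multiset.add_cons, Sym2.eq_swap, ← Multiset.cons_add, ← pathEdges_cons_cons] at hM''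
    simpa using hM''

lemma pathEdges_append_cons (l₁ l₂ : List V) (x : V) :
    pathEdges (l₁ ++ x :: l₂) = pathEdges (l₁ ++ [x]) + pathEdges (x :: l₂) := by
  cases l₂ with
  | nil => simp
  | cons y l₂ => rw [pathEdges_append, pathEdges_cons_cons]

lemma nodup_pathEdges {l : List V} (hl : l.Nodup) : (pathEdges l).Nodup := by
  induction l with
  | nil => simp
  | cons a l ih =>
    cases l with
    | nil => simp
    | cons b l =>
      rw [pathEdges_cons_cons, Multiset.nodup_cons]
      exact ⟨fun h => (List.nodup_cons.1 hl).1 (mem_of_mem_pathEdges h).1, ih hl.of_cons⟩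

lemma countP_mem_cons (v a b : V) (hab : a ≠ b) (E : Multiset (Sym2 V)) :
    (s(a, b) ::ₘ E).countP (v ∈ ·) =
      E.countP (v ∈ ·) + ((if v = a then 1 else 0) + (if v = b then 1 else 0)) := by
  rw [Multiset.countP_cons]
  by_cases ha : v = a
  · subst ha; simp [hab]
  · simp [ha]

lemma even_countP_pathEdges (v : V) (l : List V) : ∀ u, (∀ e ∈ pathEdges (u :: l), ¬ e.IsDiag) →
    Even ((pathEdges (u :: l)).countP (v ∈ ·) + ((if v = u then 1 else 0) +
      (if v = (u :: l).getLast (List.cons_ne_nil _ _) then 1 else 0))) := by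
  induction l with
  | nil => intro u _; by_cases h : v = u <;> simp [h]
  | cons w l ih =>
    intro u h
    have huw : u ≠ w := by simpa using h s(u, w) (by simp)
    have := ih w (fun e he => h e (by simp [he]))
    rw [pathEdges_cons_cons, countP_mem_cons _ _ _ huw, List.getLast_cons (List.cons_ne_nil _ _)]
    rw [Nat.even_iff] at this ⊢
    omega

lemma List.exists_first_of_mem {p : V → Prop} {l : List V} (h : ∃ w ∈ l, p w) :
    ∃ l₁ z l₂, l = l₁ ++ z :: l₂ ∧ p z ∧ ∀ w ∈ l₁, ¬ p w := by
  induction l with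
  | nil => simp at h
  | cons a l ih =>
    by_cases ha : p a
    · exact ⟨[], a, l, rfl, ha, by simp⟩
    · obtain ⟨w, hw, hpw⟩ := h
      obtain ⟨l₁, z, l₂, rfl, hz, hl⟩ := ih ⟨w, (List.mem_cons.1 hw).resolve_left
        (by rintro rfl; exact ha hpw), hpw⟩
      exact ⟨a :: l₁, z, l₂, rfl, hz, by simpa using ⟨ha, hl⟩⟩

/-- A longest path in a nonempty edge set. -/
lemma exists_longest [Fintype V] {E : Multiset (Sym2 V)} (hd : ∀ e ∈ E, ¬ e.IsDiag) (h0 : E ≠ 0) :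
    ∃ (x y : V) (l : List V), (x :: y :: l).Nodup ∧ pathEdges (x :: y :: l) ⊆ E ∧
      ∀ w, s(x, w) ∈ E → w ∈ y :: l := by
  obtain ⟨e, he⟩ := Multiset.exists_mem_of_ne_zero h0
  induction e with | _ a b =>
  have hab : a ≠ b := by simpa using hd _ he
  obtain ⟨⟨c, hc⟩, hcE, hmax⟩ := Set.exists_max_image
    {l : {l : List V // l.Nodup} | pathEdges l.1 ⊆ E} (fun l => l.1.length) (Set.toFinite _)
    ⟨⟨[a, b], by simp [hab]⟩, by simp [he]⟩
  have h2 := hmax ⟨[a, b], by simp [hab]⟩ (by simp [he])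
  match c, hc, hcE, hmax, h2 with
  | [], _, _, _, h2 => simp at h2
  | [x], _, _, _, h2 => simp at h2
  | x :: y :: l, hc, hcE, hmax, _ =>
    refine ⟨x, y, l, hc, hcE, ?_⟩
    intro w hw
    by_contra hwl
    have hwx : w ≠ x := by
      rintro rfl
      exact hd _ hw (by simp)
    have := hmax ⟨w :: x :: y :: l, List.nodup_cons.2 ⟨by simpa [hwx] using hwl, hc⟩⟩
      (by
        simp only [Set.mem_ofPred_eq] at hcE ⊢
        rw [pathEdges_cons_cons, Multiset.cons_subset, Sym2.eq_swap]
        exact ⟨hw, hcE⟩)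
    simp at this

end Gallai

section Gallai
open scoped Classical
variable {V : Type*}

/-- The ends of `M` are distributed as in Lovász's theorem: two at each vertex of even degree,
one at each vertex of odd degree. -/
def IsBalanced (E : Multiset (Sym2 V)) (T : Multiset V) : Prop :=
  ∀ v, T.count v = if Even (E.countP (v ∈ ·)) then 2 else 1

lemma IsBalanced.mem {E : Multiset (Sym2 V)} {T : Multiset V} (h : IsBalanced E T) (v : V) :
    v ∈ T := by
  rw [← Multiset.one_le_count_iff_mem, h v]
  split_ifs <;> simp

lemma exists_isDec_of_even {E : Multiset (Sym2 V)} {a b : V} {M : Multiset (List V)}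
    {T : Multiset V} (hE : (s(a, b) ::ₘ E).Nodup) (hab : a ≠ b) (hM : IsDec M E T)
    (hT : IsBalanced E T) (hb : Even ((s(a, b) ::ₘ E).countP (b ∈ ·))) :
    ∃ M T, IsDec M (s(a, b) ::ₘ E) T ∧ IsBalanced (s(a, b) ::ₘ E) T := by
  rw [Multiset.nodup_cons] at hE
  have hb' : ¬ Even (E.countP (b ∈ ·)) := by
    rw [countP_mem_cons _ _ _ hab] at hb
    simpa [hab.symm, Nat.even_add_one] using hb
  have hTb := hT b
  have hTa := hT a
  rw [if_neg hb'] at hTb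
  by_cases ha : Even (E.countP (a ∈ ·))
  · rw [if_pos ha] at hTa
    obtain ⟨T₀, rfl⟩ := Multiset.exists_cons_of_mem (hT.mem a)
    obtain ⟨M', hM'⟩ := hM.move_end hE.2 hab.symm (by rw [Sym2.eq_swap]; exact hE.1)
      (fun z _ => hT.mem z)
    rw [Sym2.eq_swap] at hM'
    refine ⟨M', _, hM', fun v => ?_⟩
    have hv := hT v
    rw [countP_mem_cons _ _ _ hab]
    rw [Multiset.count_cons] at hv hTa hTb ⊢
    by_cases hva : v = a
    · subst hva
      simp_all [Nat.even_add_one]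
    · by_cases hvb : v = b
      · subst hvb
        simp_all [Nat.even_add_one]
      · simpa [hva, hvb] using hv
  · rw [if_neg ha] at hTa
    obtain ⟨T₀, rfl⟩ := Multiset.exists_cons_of_mem (hT.mem b)
    obtain ⟨M', hM'⟩ := hM.move_end hE.2 hab hE.1 (fun z _ => hT.mem z)
    refine ⟨[b] ::ₘ M', b ::ₘ b ::ₘ a ::ₘ T₀, ⟨?_, ?_, ?_⟩, fun v => ?_⟩
    · intro l hl
      rcases Multiset.mem_cons.1 hl with rfl | hl
      · simp
      · exact hM'.nodup l hl
    · rw [Multiset.cons_bind, hM'.edges]; simp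
    · rw [Multiset.cons_bind, hM'.ends]
      simp only [pathEnds, List.head?_cons, List.getLast?_singleton, Multiset.insert_eq_cons,
        Multiset.cons_add, Multiset.singleton_add, Multiset.map_cons]
    have hv := hT v
    rw [countP_mem_cons _ _ _ hab]
    simp only [Multiset.count_cons] at hv hTa hTb ⊢
    by_cases hva : v = a
    · subst hva
      simp_all
    · by_cases hvb : v = b
      · subst hvb
        simp_all
      · simpa [hva, hvb] using hv

lemma exists_isDec_of_leaf {E : Multiset (Sym2 V)} {x y : V} {M : Multiset (List V)}
    {T : Multiset V} (hE : (s(x, y) ::ₘ E).Nodup) (hxy : x ≠ y) (hM : IsDec M E T)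
    (hT : IsBalanced E T) (hx : ∀ z, s(x, z) ∉ E) (hy : Even (E.countP (y ∈ ·))) :
    ∃ M T, IsDec M (s(x, y) ::ₘ E) T ∧ IsBalanced (s(x, y) ::ₘ E) T := by
  rw [Multiset.nodup_cons] at hE
  have hx0 : E.countP (x ∈ ·) = 0 := by
    rw [Multiset.countP_eq_zero]
    intro e he hxe
    obtain ⟨z, rfl⟩ := Sym2.mem_iff_exists.1 hxe
    exact hx z he
  obtain ⟨l, hl⟩ := hM.exists_head (hT.mem x)
  obtain ⟨M₁, hM₁, _⟩ := hM.exists_cons hl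
  have hl0 : l = [] := by
    cases l with
    | nil => rfl
    | cons w l =>
      refine absurd ?_ (hx w)
      rw [← hM₁.edges]
      simp
  subst hl0
  have hTx : T.count x = 2 := by rw [hT x, hx0]; simp
  have hTy : T.count y = 2 := by rw [hT y, if_pos hy]
  have hends := hM₁.ends
  obtain ⟨T₁, rfl⟩ := Multiset.exists_cons_of_mem (hT.mem x)
  obtain ⟨T₀, rfl⟩ := Multiset.exists_cons_of_mem (a := x) (s := T₁) (by
    rw [← Multiset.one_le_count_iff_mem]
    simp at hTx; omega)
  obtain ⟨T₁, rfl⟩ := Multiset.exists_cons_of_mem (a := y) (s := T₀) (by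
    rw [← Multiset.one_le_count_iff_mem]
    simp [hxy.symm] at hTy; omega)
  have hM₂ : IsDec M₁ E (y ::ₘ T₁) := by
    refine ⟨fun q hq => hM₁.nodup q (Multiset.mem_cons_of_mem hq), ?_, ?_⟩
    · simpa using hM₁.edges
    · simpa [pathEnds] using hends
  obtain ⟨M', hM'⟩ := hM₂.move_end hE.2 hxy hE.1 (fun z hz => absurd hz (hx z))
  refine ⟨M', _, hM', fun v => ?_⟩
  have hv := hT v
  rw [countP_mem_cons _ _ _ hxy]
  simp only [Multiset.count_cons] at hv hTx hTy ⊢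
  by_cases hva : v = x
  · subst hva
    simp_all
  · by_cases hvb : v = y
    · subst hvb
      simp_all [Nat.even_add_one]
    · simpa [hva, hvb] using hv

lemma exists_isDec_of_cycle {E : Multiset (Sym2 V)} {x y z : V} {l : List V}
    {M : Multiset (List V)} {T : Multiset V}
    (hl : (x :: y :: (l ++ [z])).Nodup)
    (hE : (s(z, x) ::ₘ (pathEdges (x :: y :: (l ++ [z])) + E)).Nodup)
    (hx : ∀ w ∈ l, s(w, x) ∉ E) (hM : IsDec M E T) (hT : IsBalanced E T) :
    ∃ M T, IsDec M (s(z, x) ::ₘ (pathEdges (x :: y :: (l ++ [z])) + E)) T ∧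
      IsBalanced (s(z, x) ::ₘ (pathEdges (x :: y :: (l ++ [z])) + E)) T := by
  obtain ⟨T₀, rfl⟩ := Multiset.exists_cons_of_mem (hT.mem x)
  have hT₀ : ∀ v, v ≠ x → v ∈ T₀ := fun v hv =>
    (Multiset.mem_cons.1 (hT.mem v)).resolve_left hv
  rw [Multiset.nodup_cons] at hE
  have hxl := (List.nodup_cons.1 hl).1
  obtain ⟨M', hM'⟩ := hM.move_end_along hT₀ (y :: (l ++ [z])) x M E hl hE.2 hxl (by
    intro w hw h
    have h1 := (Multiset.nodup_add.1 hE.2).2.2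
    simp only [List.mem_cons, List.mem_append, List.not_mem_nil, or_false] at hw
    rcases hw with rfl | hw | rfl
    · refine Multiset.disjoint_left.1 h1 ?_ h
      simp [Sym2.eq_swap]
    · exact hx w hw h
    · exact hE.1 (Multiset.mem_add.2 (Or.inr h)))
  have hlast : (x :: y :: (l ++ [z])).getLast (List.cons_ne_nil _ _) = z := by simp
  rw [hlast] at hM'
  have hxz : x ≠ z := by
    rintro rfl
    simp at hxl
  obtain ⟨M'', hM''⟩ := hM'.move_end hE.2 hxz (by rw [Sym2.eq_swap]; exact hE.1) (by
    intro w hw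
    refine Multiset.mem_cons_of_mem (hT₀ w ?_)
    rintro rfl
    exact hM'.not_isDiag hw (by simp))
  rw [Sym2.eq_swap] at hM''
  refine ⟨M'', _, hM'', fun v => ?_⟩
  rw [hT v]
  have := even_countP_pathEdges v (y :: (l ++ [z])) x
    (fun e he => not_isDiag_of_mem_pathEdges hl he)
  rw [hlast] at this
  rw [countP_mem_cons _ _ _ hxz.symm, Multiset.countP_add]
  congr 1
  rw [eq_iff_iff, Nat.even_iff, Nat.even_iff]
  rw [Nat.even_iff] at this
  omega

/-- A form of Lovász's theorem with control of the ends. -/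
theorem exists_isDec_isBalanced [Fintype V] (n : ℕ) : ∀ E : Multiset (Sym2 V), E.card = n →
    E.Nodup → (∀ e ∈ E, ¬ e.IsDiag) → ∃ M T, IsDec M E T ∧ IsBalanced E T := by
  induction n using Nat.strong_induction_on with
  | _ n ih =>
  intro E hn hE hd
  have IH : ∀ F E', E = F + E' → F ≠ 0 → ∃ M T, IsDec M E' T ∧ IsBalanced E' T := by
    rintro F E' rfl hF
    refine ih E'.card ?_ E' rfl (Multiset.nodup_add.1 hE).2.1
      (fun e he => hd e (Multiset.mem_add.2 (Or.inr he)))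
    rw [← hn, Multiset.card_add]
    have := Multiset.card_pos.2 hF
    omega
  by_cases h0 : E = 0
  · subst h0
    refine ⟨Finset.univ.val.map (fun v => [v]), Finset.univ.val + Finset.univ.val, ⟨?_, ?_, ?_⟩, ?_⟩
    · intro l hl
      obtain ⟨v, _, rfl⟩ := Multiset.mem_map.1 hl
      simp
    · simp [Multiset.bind_map]
    · simp [Multiset.bind_map, pathEnds, Multiset.map_add, ← Multiset.singleton_add]
    · intro v
      simp
  by_cases hev : ∃ a b, s(a, b) ∈ E ∧ Even (E.countP (b ∈ ·))
  · obtain ⟨a, b, hab, hb⟩ := hev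
    have hne : a ≠ b := by simpa using hd _ hab
    obtain ⟨E', rfl⟩ := Multiset.exists_cons_of_mem hab
    obtain ⟨M, T, hM, hT⟩ := IH {s(a, b)} E' (by simp) (by simp)
    exact exists_isDec_of_even hE hne hM hT hb
  push Not at hev
  obtain ⟨x, y, l, hl, hlE, hmax⟩ := exists_longest hd h0
  have hxyE : s(x, y) ∈ E := hlE (by simp)
  have hxy : x ≠ y := by simpa using hd _ hxyE
  by_cases hx : ∃ w ∈ l, s(w, x) ∈ E
  · obtain ⟨l₁, z, l₂, rfl, hz, hl₁⟩ := List.exists_first_of_mem hx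
    have hl' : (x :: y :: (l₁ ++ [z])).Nodup := by
      refine List.Nodup.sublist ?_ hl
      simp
    have hle : s(z, x) ::ₘ pathEdges (x :: y :: (l₁ ++ [z])) ≤ E := by
      rw [Multiset.le_iff_subset, Multiset.cons_subset]
      · refine ⟨hz, fun e he => hlE ?_⟩
        have := pathEdges_append_cons (x :: y :: l₁) l₂ z
        simp only [List.cons_append] at this
        rw [this]
        exact Multiset.mem_add.2 (Or.inl he)
      · rw [Multiset.nodup_cons]
        refine ⟨?_, nodup_pathEdges hl'⟩
        simp only [List.nodup_cons] at hl'
        rw [pathEdges_cons_cons, Multiset.mem_cons, not_or]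
        refine ⟨?_, fun h => hl'.1 (mem_of_mem_pathEdges h).2⟩
        intro h
        rw [Sym2.eq_swap] at h
        have := Sym2.congr_right.1 h
        subst this
        simp at hl'
    obtain ⟨E', rfl⟩ := Multiset.le_iff_exists_add.1 hle
    obtain ⟨M, T, hM, hT⟩ := IH _ E' rfl (by simp)
    rw [Multiset.cons_add] at hE ⊢
    exact exists_isDec_of_cycle hl' hE
      (fun w hw h => hl₁ w hw (Multiset.mem_add.2 (Or.inr h))) hM hT
  · push Not at hx
    have hyodd := hev x y hxyE
    obtain ⟨E', rfl⟩ := Multiset.exists_cons_of_mem hxyE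
    obtain ⟨M, T, hM, hT⟩ := IH {s(x, y)} E' (by simp) (by simp)
    refine exists_isDec_of_leaf hE hxy hM hT ?_ ?_
    · intro z hz
      have := hmax z (Multiset.mem_cons_of_mem hz)
      rcases List.mem_cons.1 this with rfl | h
      · exact (Multiset.nodup_cons.1 hE).1 hz
      · exact hx z h (Multiset.mem_cons_of_mem (by rwa [Sym2.eq_swap]))
    · rw [countP_mem_cons _ _ _ hxy] at hyodd
      simpa [hxy.symm, Nat.even_add_one] using hyodd

end Gallai

section Orientation
open scoped Classical

lemma Multiset.exists_cons_cons_of_not_nodup_map {α β : Type*} (f : α → β) (L : Multiset α)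
    (h : ¬ (L.map f).Nodup) : ∃ p q L₀, L = p ::ₘ q ::ₘ L₀ ∧ f p = f q := by
  induction L using Multiset.induction_on with
  | empty => simp at h
  | cons a L ih =>
    rw [Multiset.map_cons, Multiset.nodup_cons, not_and_or, not_not] at h
    rcases h with h | h
    · obtain ⟨q, hq, hqa⟩ := Multiset.mem_map.1 h
      obtain ⟨L₀, rfl⟩ := Multiset.exists_cons_of_mem hq
      exact ⟨a, q, L₀, rfl, hqa.symm⟩
    · obtain ⟨p, q, L₀, rfl, hpq⟩ := ih h
      exact ⟨p, q, a ::ₘ L₀, by rw [Multiset.cons_swap a p, Multiset.cons_swap a q], hpq⟩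

/-- Equality of ordered pairs up to swapping the coordinates. -/
def EqOrSwap {α : Type*} (p q : α × α) : Prop := q = p ∨ q = p.swap

lemma EqOrSwap.add_eq {α : Type*} {L L' : Multiset (α × α)} (h : Multiset.Rel EqOrSwap L L') :
    L'.map Prod.fst + L'.map Prod.snd = L.map Prod.fst + L.map Prod.snd := by
  induction h with
  | zero => rfl
  | @cons p q L L' hpq _ ih =>
    have : ({q.1} : Multiset α) + {q.2} = {p.1} + {p.2} := by
      rcases hpq with rfl | rfl
      · rfl
      · exact add_comm _ _
    simp only [← Multiset.singleton_add, Multiset.map_add, Multiset.map_singleton]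
    rw [add_add_add_comm, this, ih, add_add_add_comm]

/-- A multigraph of maximum degree two has an orientation with in- and out-degrees
at most one. -/
lemma exists_orientation {α : Type*} (n : ℕ) : ∀ L : Multiset (α × α), L.card = n →
    (∀ v, (L.map Prod.fst + L.map Prod.snd).count v ≤ 2) →
    ∃ L', Multiset.Rel EqOrSwap L L' ∧ (L'.map Prod.fst).Nodup ∧ (L'.map Prod.snd).Nodup := by
  induction n using Nat.strong_induction_on with
  | _ n ih =>
  intro L hn hL
  have key : ∀ (v a b : α) (p q : α × α) (L₀ : Multiset (α × α)), L = p ::ₘ q ::ₘ L₀ →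
      EqOrSwap p (v, a) → EqOrSwap q (v, b) →
      ∃ L', Multiset.Rel EqOrSwap L L' ∧ (L'.map Prod.fst).Nodup ∧ (L'.map Prod.snd).Nodup := by
    rintro v a b p q L₀ rfl hp hq
    have hL₁ : ∀ w, (L₀.map Prod.fst + L₀.map Prod.snd).count w +
        (if w = a then 1 else 0) + (if w = b then 1 else 0) + (if w = v then 2 else 0) ≤ 2 := by
      intro w
      refine le_trans (le_of_eq ?_) (hL w)
      rcases hp with hp | hp <;> rcases hq with hq | hq <;>
        · obtain ⟨p₁, p₂⟩ := p
          obtain ⟨q₁, q₂⟩ := q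
          simp only [Prod.swap_prod_mk, Prod.mk.injEq] at hp hq
          obtain ⟨rfl, rfl⟩ := hp
          obtain ⟨h1, rfl⟩ := hq
          subst h1
          simp only [Multiset.map_cons, Multiset.count_add, Multiset.count_cons]
          split_ifs <;> omega
    obtain ⟨L₁, hL₁R, h1, h2⟩ := ih ((a, b) ::ₘ L₀).card (by simp at hn ⊢; omega)
      ((a, b) ::ₘ L₀) rfl (by
        intro w
        have := hL₁ w
        simp only [Multiset.map_cons, Multiset.count_add, Multiset.count_cons] at this ⊢
        omega)
    obtain ⟨r, L', hr, hR, rfl⟩ := Multiset.rel_cons_left.1 hL₁R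
    have hv := hL₁ v
    rw [if_pos rfl, ← EqOrSwap.add_eq hR, Multiset.count_add] at hv
    have hv1 : v ∉ L'.map Prod.fst := by rw [← Multiset.count_eq_zero]; omega
    have hv2 : v ∉ L'.map Prod.snd := by rw [← Multiset.count_eq_zero]; omega
    have hva : v ≠ a := by rintro rfl; simp at hv
    have hvb : v ≠ b := by rintro rfl; simp at hv
    have hp' : EqOrSwap p (a, v) := by
      rcases hp with h | h
      · right; rw [← h]; rfl
      · left; rw [← Prod.swap_swap p, ← h]; rfl
    have hq' : EqOrSwap q (b, v) := by
      rcases hq with h | h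
      · right; rw [← h]; rfl
      · left; rw [← Prod.swap_swap q, ← h]; rfl
    rcases hr with rfl | rfl
    · refine ⟨(a, v) ::ₘ (v, b) ::ₘ L', .cons hp' (.cons hq hR), ?_, ?_⟩
      · simp only [Multiset.map_cons, Multiset.nodup_cons, Multiset.mem_cons, not_or] at h1 ⊢
        exact ⟨⟨hva.symm, h1.1⟩, hv1, h1.2⟩
      · simp only [Multiset.map_cons, Multiset.nodup_cons, Multiset.mem_cons, not_or] at h2 ⊢
        exact ⟨⟨hvb, hv2⟩, h2⟩
    · refine ⟨(v, a) ::ₘ (b, v) ::ₘ L', .cons hp (.cons hq' hR), ?_, ?_⟩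
      · simp only [Multiset.map_cons, Multiset.nodup_cons, Multiset.mem_cons, not_or] at h1 ⊢
        exact ⟨⟨hvb, hv1⟩, h1⟩
      · simp only [Multiset.map_cons, Multiset.nodup_cons, Multiset.mem_cons, not_or] at h2 ⊢
        exact ⟨⟨hva.symm, h2.1⟩, hv2, h2.2⟩
  by_cases h1 : (L.map Prod.fst).Nodup
  · by_cases h2 : (L.map Prod.snd).Nodup
    · exact ⟨L, Multiset.rel_refl_of_refl_on (fun _ _ => Or.inl rfl), h1, h2⟩
    · obtain ⟨⟨a, v⟩, ⟨b, w⟩, L₀, rfl, rfl : v = w⟩ :=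
        Multiset.exists_cons_cons_of_not_nodup_map _ _ h2
      exact key v a b _ _ L₀ rfl (Or.inr rfl) (Or.inr rfl)
  · obtain ⟨⟨v, a⟩, ⟨w, b⟩, L₀, rfl, rfl : v = w⟩ :=
      Multiset.exists_cons_cons_of_not_nodup_map _ _ h1
    exact key v a b _ _ L₀ rfl (Or.inl rfl) (Or.inl rfl)

variable {V : Type*}

lemma bind_pathEnds (M : Multiset (List V)) :
    M.bind pathEnds = M.map List.head? + M.map List.getLast? := by
  induction M using Multiset.induction_on with
  | empty => rfl
  | cons l M ih =>
    rw [Multiset.cons_bind, ih, Multiset.map_cons, Multiset.map_cons]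
    simp only [pathEnds, Multiset.insert_eq_cons, ← Multiset.singleton_add]
    rw [add_add_add_comm]

lemma exists_reorientation {M : Multiset (List V)} {L : Multiset (Option V × Option V)}
    (h : Multiset.Rel (fun l q => EqOrSwap (l.head?, l.getLast?) q) M L) :
    ∃ M' : Multiset (List V), M'.map (fun l => (l.head?, l.getLast?)) = L ∧
      M'.bind pathEdges = M.bind pathEdges ∧ ∀ l ∈ M', l ∈ M ∨ l.reverse ∈ M := by
  induction h with
  | zero => exact ⟨0, by simp⟩
  | @cons l q M L hlq _ ih =>
    obtain ⟨M', rfl, hE, hM⟩ := ih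
    obtain ⟨l', hl', rfl⟩ : ∃ l', (l' = l ∨ l' = l.reverse) ∧ (l'.head?, l'.getLast?) = q := by
      rcases hlq with rfl | rfl
      · exact ⟨l, Or.inl rfl, rfl⟩
      · exact ⟨l.reverse, Or.inr rfl, by simp⟩
    refine ⟨l' ::ₘ M', by simp, ?_, ?_⟩
    · rw [Multiset.cons_bind, Multiset.cons_bind, hE]
      rcases hl' with rfl | rfl
      · rfl
      · rw [pathEdges_reverse]
    · intro k hk
      rcases Multiset.mem_cons.1 hk with rfl | hk
      · rcases hl' with rfl | rfl <;> simp
      · exact (hM k hk).imp Multiset.mem_cons_of_mem Multiset.mem_cons_of_mem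

lemma Multiset.exists_map_some_eq (s : Multiset (Option V)) (hs : ∀ x ∈ s, x.isSome) :
    ∃ t : Multiset V, t.map some = s := by
  induction s using Multiset.induction_on with
  | empty => exact ⟨0, rfl⟩
  | cons a s ih =>
    obtain ⟨t, rfl⟩ := ih (fun x hx => hs x (Multiset.mem_cons_of_mem hx))
    obtain ⟨v, rfl⟩ := Option.isSome_iff_exists.1 (hs a (Multiset.mem_cons_self _ _))
    exact ⟨v ::ₘ t, Multiset.map_cons _ _ _⟩

/-- Every finite graph has a decomposition into oriented paths such that every vertex is
the first vertex of at most one path, the last vertex of at most one path, and is an end of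
some path. -/
theorem exists_oriented_decomposition [Fintype V] (E : Multiset (Sym2 V)) (hE : E.Nodup)
    (hd : ∀ e ∈ E, ¬ e.IsDiag) :
    ∃ (M : Multiset (List V)) (S L : Finset V), (∀ l ∈ M, l.Nodup) ∧ M.bind pathEdges = E ∧
      M.map List.head? = S.val.map some ∧ M.map List.getLast? = L.val.map some ∧
      ∀ v, v ∈ S ∨ v ∈ L := by
  obtain ⟨M, T, hM, hT⟩ := exists_isDec_isBalanced _ E rfl hE hd
  have hends := hM.ends
  obtain ⟨L', hR, h1, h2⟩ := exists_orientation _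
    (M.map (fun l => (l.head?, l.getLast?))) rfl (by
      intro v
      simp only [Multiset.map_map, Function.comp_def]
      rw [← bind_pathEnds, hends]
      cases v with
      | none => simp
      | some v =>
        refine le_of_eq_of_le (b := T.count v) ?_ (by rw [hT v]; split_ifs <;> simp)
        convert Multiset.count_map_eq_count' _ T (Option.some_injective _) v)
  have hadd := EqOrSwap.add_eq hR
  rw [Multiset.rel_map_left] at hR
  obtain ⟨M', rfl, hE', hM'⟩ := exists_reorientation hR
  simp only [Multiset.map_map, Function.comp_def] at h1 h2 hadd
  rw [← bind_pathEnds, ← bind_pathEnds, hends, bind_pathEnds] at hadd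
  have hs : ∀ x ∈ T.map some, x.isSome := by simp
  obtain ⟨S, hS⟩ : ∃ S : Multiset V, S.map some = M'.map List.head? :=
    Multiset.exists_map_some_eq (M'.map List.head?) (fun x hx => hs x (by
      rw [← hadd]; exact Multiset.mem_add.2 (Or.inl hx)))
  obtain ⟨L, hL⟩ : ∃ L : Multiset V, L.map some = M'.map List.getLast? :=
    Multiset.exists_map_some_eq (M'.map List.getLast?) (fun x hx => hs x (by
      rw [← hadd]; exact Multiset.mem_add.2 (Or.inr hx)))
  rw [← hS] at h1 hadd
  rw [← hL, ← Multiset.map_add] at hadd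
  rw [← hL] at h2
  refine ⟨M', ⟨S, h1.of_map⟩, ⟨L, h2.of_map⟩, ?_, by rw [hE', hM.edges], hS.symm, hL.symm, ?_⟩
  · intro l hl
    rcases hM' l hl with h | h
    · exact hM.nodup l h
    · exact List.nodup_reverse.1 (hM.nodup _ h)
  · intro v
    have := hT.mem v
    rw [← Multiset.map_injective (Option.some_injective _) hadd] at this
    exact Multiset.mem_add.1 this

end Orientation

section Zigzag
variable {I V : Type*}

/-- Every second edge of a path, starting with the first edge (`true`) or
the second edge (`false`). -/
def altEdges : Bool → List I → Multiset (Sym2 I)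
  | b, i :: j :: l => (if b then {s(i, j)} else 0) + altEdges (!b) (j :: l)
  | _, _ => 0

@[simp] lemma altEdges_nil (b : Bool) : altEdges b ([] : List I) = 0 := by cases b <;> rfl
@[simp] lemma altEdges_singleton (b : Bool) (i : I) : altEdges b [i] = 0 := by cases b <;> rfl
@[simp] lemma altEdges_true_cons_cons (i j : I) (l : List I) :
    altEdges true (i :: j :: l) = s(i, j) ::ₘ altEdges false (j :: l) := by
  simp [altEdges, Multiset.singleton_add]
@[simp] lemma altEdges_false_cons_cons (i j : I) (l : List I) :
    altEdges false (i :: j :: l) = altEdges true (j :: l) := by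
  simp [altEdges]

lemma altEdges_true_add_false (l : List I) :
    altEdges true l + altEdges false l = pathEdges l := by
  induction l with
  | nil => simp
  | cons i l ih =>
    cases l with
    | nil => simp
    | cons j l => simp [← ih, add_comm]

lemma card_altEdges (l : List I) : (altEdges true l).card = l.length / 2 ∧
    (altEdges false l).card = (l.length - 1) / 2 := by
  induction l with
  | nil => simp
  | cons i l ih =>
    cases l with
    | nil => simp
    | cons j l =>
      simp only [altEdges_true_cons_cons, altEdges_false_cons_cons, Multiset.card_cons,
        List.length_cons] at ih ⊢
      omega

/-- The path that runs through the copies of `P` in the layers `l`, alternating the direction. -/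
def zigzag : List I → List V → List (I × V)
  | [], _ => []
  | i :: l, P => P.map (Prod.mk i) ++ zigzag l P.reverse

lemma fst_mem_of_mem_zigzag (l : List I) :
    ∀ (P : List V) (x : I × V), x ∈ zigzag l P → x.1 ∈ l := by
  induction l with
  | nil => intro P x hx; simp [zigzag] at hx
  | cons i l ih =>
    intro P x hx
    rcases List.mem_append.1 hx with hx | hx
    · obtain ⟨v, _, rfl⟩ := List.mem_map.1 hx
      simp
    · exact List.mem_cons_of_mem _ (ih _ _ hx)

lemma nodup_zigzag {l : List I} (hl : l.Nodup) : ∀ {P : List V}, P.Nodup → (zigzag l P).Nodup := by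
  induction l with
  | nil => intro P _; simp [zigzag]
  | cons i l ih =>
    intro P hP
    refine List.nodup_append.2 ⟨hP.map (Prod.mk_right_injective i),
      ih hl.of_cons (List.nodup_reverse.2 hP), ?_⟩
    rintro x hx y hy rfl
    obtain ⟨v, _, rfl⟩ := List.mem_map.1 hx
    exact (List.nodup_cons.1 hl).1 (fst_mem_of_mem_zigzag _ _ _ hy)

lemma pathEdges_zigzag (l : List I) : ∀ (P : List V) (h t : V), P.head? = some h →
    P.getLast? = some t → pathEdges (zigzag l P) =
      (l : Multiset I).bind (fun i => (pathEdges P).map (Sym2.map (Prod.mk i))) +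
      ((altEdges true l).map (Sym2.map (fun i => (i, t))) +
        (altEdges false l).map (Sym2.map (fun i => (i, h)))) := by
  induction l with
  | nil => intro P h t _ _; simp [zigzag]
  | cons i l ih =>
    intro P h t hh ht
    cases l with
    | nil => simp [zigzag, pathEdges_map, ← Multiset.cons_coe]
    | cons j l =>
      have IH := ih P.reverse t h (by simpa using ht) (by simpa using hh)
      obtain ⟨P₀, rfl⟩ := List.getLast?_eq_some_iff.1 ht
      have hz : zigzag (j :: l) (P₀ ++ [t]).reverse =
          (j, t) :: (P₀.reverse.map (Prod.mk j) ++ zigzag l (P₀ ++ [t])) := by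
        simp [zigzag]
      have hz' : zigzag (i :: j :: l) (P₀ ++ [t]) = P₀.map (Prod.mk i) ++
          (i, t) :: (j, t) :: (P₀.reverse.map (Prod.mk j) ++ zigzag l (P₀ ++ [t])) := by
        rw [zigzag, hz]; simp
      rw [hz', pathEdges_append, ← hz, IH, pathEdges_reverse, ← Multiset.cons_coe i,
        Multiset.cons_bind, ← pathEdges_map, List.map_append, List.map_singleton]
      simp only [altEdges_true_cons_cons, altEdges_false_cons_cons, Multiset.map_cons,
        Sym2.map_mk, Multiset.add_cons, Multiset.cons_add]
      congr 1
      rw [add_assoc, add_comm (Multiset.map _ (altEdges true (j :: l)))]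

lemma exists_right_end (b : Bool) (x y z : I) (pre : List I) : (pre ++ [x, y, z]).Nodup →
    ∃ ex : Multiset (List I), (∀ q ∈ ex, q.Nodup) ∧
      ex.bind pathEdges = s(x, z) ::ₘ altEdges b (pre ++ [x, y, z]) ∧
      ex.card = (altEdges b (pre ++ [x, y, z])).card := by
  induction pre generalizing b with
  | nil =>
    intro h
    simp only [List.nil_append, List.nodup_cons, List.mem_cons, List.not_mem_nil, or_false,
      not_or] at h
    cases b
    · exact ⟨{[x, z, y]}, by simp_all [eq_comm], by simp [Sym2.eq_swap], by simp⟩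
    · refine ⟨{[y, x, z]}, by simp_all [eq_comm], ?_, by simp⟩
      simp [Sym2.eq_swap, ← Multiset.singleton_add, add_comm]
  | cons i pre ih =>
    intro h
    obtain ⟨ex, h1, h2, h3⟩ := ih (!b) h.of_cons
    obtain ⟨j, R, hR⟩ : ∃ j R, pre ++ [x, y, z] = j :: R :=
      List.exists_cons_of_ne_nil (by simp)
    rw [List.cons_append, hR] at h ⊢
    rw [hR] at h2 h3
    cases b
    · exact ⟨ex, h1, by simpa using h2, by simpa using h3⟩
    · refine ⟨[i, j] ::ₘ ex, ?_, ?_, by simpa using h3⟩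
      · intro q hq
        rcases Multiset.mem_cons.1 hq with rfl | hq
        · simp only [List.nodup_cons, List.mem_cons, not_or] at h
          simpa using h.1.1
        · exact h1 q hq
      · rw [Multiset.cons_bind, h2]
        simp

/-- The edges of the fibre left over by the zigzag paths can be covered by few paths. -/
lemma exists_fibre_paths (a b c x y z : I) (pre : List I) (l : List I)
    (hl : l = a :: b :: c :: (pre ++ [x, y, z])) (hnd : l.Nodup) (p q : Prop) [Decidable p]
    [Decidable q] (hpq : p ∨ q) :
    ∃ ex : Multiset (List I), (∀ q ∈ ex, q.Nodup) ∧
      (if q then altEdges true l else 0) + (if p then altEdges false l else 0) +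
        ex.bind pathEdges = pathEdges l + {s(a, c), s(x, z)} ∧
      2 * ex.card + ((if p then 1 else 0) + (if q then 1 else 0)) ≤ l.length := by
  subst hl
  have hnd' := hnd
  simp only [List.nodup_cons, List.mem_cons, not_or] at hnd'
  by_cases hq : q
  · by_cases hp : p
    · refine ⟨{[a, c], [x, z]}, ?_, ?_, ?_⟩
      · have : (pre ++ [x, y, z]).Nodup := hnd.of_cons.of_cons.of_cons
        have hxyz := (List.nodup_append.1 this).2.1
        simp only [List.nodup_cons, List.mem_cons, not_or] at hxyz
        intro q hq
        simp only [Multiset.insert_eq_cons, Multiset.mem_cons, Multiset.mem_singleton] at hq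
        rcases hq with rfl | rfl
        · simpa using hnd'.1.2.1
        · simpa using hxyz.1.2.1
      · rw [if_pos hp, if_pos hq, altEdges_true_add_false]
        simp
      · simp [hp, hq]
    · obtain ⟨ex, h1, h2, h3⟩ := exists_right_end false x y z (c :: pre) hnd.of_cons.of_cons
      refine ⟨[b, c, a] ::ₘ ex, ?_, ?_, ?_⟩
      · intro r hr
        rcases Multiset.mem_cons.1 hr with rfl | hr
        · simp only [List.nodup_cons, List.mem_cons, not_or, List.not_mem_nil]
          exact ⟨⟨hnd'.2.1.1, Ne.symm hnd'.1.1, id⟩, ⟨Ne.symm hnd'.1.2.1, id⟩, id, List.nodup_nil⟩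
        · exact h1 r hr
      · rw [if_neg hp, if_pos hq, ← altEdges_true_add_false, Multiset.cons_bind, h2]
        simp only [altEdges_true_cons_cons, altEdges_false_cons_cons, pathEdges_cons_cons,
          pathEdges_singleton, Sym2.eq_swap (a := c) (b := a), List.cons_append,
          Multiset.insert_eq_cons, ← Multiset.singleton_add]
        abel
      · rw [(card_altEdges _).2] at h3
        simp only [hp, hq, Multiset.card_cons, h3, List.length_cons, List.length_append,
          List.length_nil, if_true, if_false]
        omega
  · have hp : p := hpq.resolve_right hq
    obtain ⟨ex, h1, h2, h3⟩ := exists_right_end false x y z pre hnd.of_cons.of_cons.of_cons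
    obtain ⟨d, R, hR⟩ : ∃ d R, pre ++ [x, y, z] = d :: R :=
      List.exists_cons_of_ne_nil (by simp)
    rw [(card_altEdges _).2] at h3
    rw [hR] at h2 h3 hnd hnd' ⊢
    simp only [List.mem_cons, not_or] at hnd'
    refine ⟨[b, a, c, d] ::ₘ ex, ?_, ?_, ?_⟩
    · intro r hr
      rcases Multiset.mem_cons.1 hr with rfl | hr
      · simp only [List.nodup_cons, List.mem_cons, not_or, List.not_mem_nil]
        exact ⟨⟨Ne.symm hnd'.1.1, hnd'.2.1.1, hnd'.2.1.2.1, id⟩,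
          ⟨hnd'.1.2.1, hnd'.1.2.2.1, id⟩, ⟨hnd'.2.2.1.1, id⟩, id, List.nodup_nil⟩
      · exact h1 r hr
    · rw [if_pos hp, if_neg hq, ← altEdges_true_add_false, Multiset.cons_bind, h2]
      simp only [altEdges_true_cons_cons, altEdges_false_cons_cons, pathEdges_cons_cons,
        pathEdges_singleton, Sym2.eq_swap (a := b) (b := a),
        Multiset.insert_eq_cons, ← Multiset.singleton_add]
      abel
    · simp only [hp, hq, Multiset.card_cons, h3, List.length_cons, if_true, if_false]
      omega

end Zigzag

section Walks
variable {V : Type*}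

lemma SimpleGraph.exists_walk_of_pathEdges (G : SimpleGraph V) (l : List V) : ∀ u : V,
    (∀ e ∈ pathEdges (u :: l), e ∈ G.edgeSet) →
    ∃ (v : V) (p : G.Walk u v), p.support = u :: l ∧ ∀ e, e ∈ p.edges ↔ e ∈ pathEdges (u :: l) := by
  induction l with
  | nil => intro u _; exact ⟨u, .nil, by simp⟩
  | cons w l ih =>
    intro u h
    obtain ⟨v, p, hp, hpe⟩ := ih w (fun e he => h e (by simp [he]))
    have huw : G.Adj u w := h s(u, w) (by simp)
    exact ⟨v, .cons huw p, by simp [hp], by simp [hpe]⟩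

lemma SimpleGraph.exists_walks_of_lists (G : SimpleGraph V) (M : Multiset (List V)) :
    (∀ l ∈ M, l.Nodup) → (M.bind pathEdges).Nodup → (∀ e ∈ M.bind pathEdges, e ∈ G.edgeSet) →
    ∃ P : List (Σ u v : V, G.Walk u v), P.length ≤ M.card ∧ (∀ p ∈ P, p.2.2.IsPath) ∧
      P.Pairwise (fun p q => ∀ e ∈ p.2.2.edges, e ∉ q.2.2.edges) ∧
      ∀ e, e ∈ M.bind pathEdges ↔ ∃ p ∈ P, e ∈ p.2.2.edges := by
  induction M using Multiset.induction_on with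
  | empty => intro _ _ _; exact ⟨[], by simp⟩
  | cons l M ih =>
    intro h1 h2 h3
    rw [Multiset.cons_bind] at h2 h3 ⊢
    rw [Multiset.nodup_add] at h2
    obtain ⟨P, hP1, hP2, hP3, hP4⟩ := ih (fun k hk => h1 k (Multiset.mem_cons_of_mem hk)) h2.2.1
      (fun e he => h3 e (Multiset.mem_add.2 (Or.inr he)))
    cases l with
    | nil => exact ⟨P, by rw [Multiset.card_cons]; omega, hP2, hP3, by simpa using hP4⟩
    | cons u l =>
      obtain ⟨v, p, hp, hpe⟩ := G.exists_walk_of_pathEdges l u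
        (fun e he => h3 e (Multiset.mem_add.2 (Or.inl he)))
      refine ⟨⟨u, v, p⟩ :: P, by simpa using hP1, ?_, ?_, ?_⟩
      · intro q hq
        rcases List.mem_cons.1 hq with rfl | hq
        · rw [Walk.isPath_def, hp]
          exact h1 _ (Multiset.mem_cons_self _ _)
        · exact hP2 q hq
      · refine List.pairwise_cons.2 ⟨fun q hq e he he' => ?_, hP3⟩
        exact Multiset.disjoint_left.1 h2.2.2 ((hpe e).1 he) ((hP4 e).2 ⟨q, hq, he'⟩)
      · intro e
        simp [hpe, hP4]

lemma SimpleGraph.pathNumber_le_card (G : SimpleGraph V) (M : Multiset (List V))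
    (h1 : ∀ l ∈ M, l.Nodup) (h2 : (M.bind pathEdges).Nodup)
    (h3 : ∀ e, e ∈ M.bind pathEdges ↔ e ∈ G.edgeSet) : G.pathNumber ≤ M.card := by
  obtain ⟨P, hP1, hP2, hP3, hP4⟩ := G.exists_walks_of_lists M h1 h2 (fun e => (h3 e).1)
  exact le_trans (Nat.sInf_le ⟨P, ⟨hP2, hP3, fun e he => (hP4 e).1 ((h3 e).2 he)⟩, rfl⟩) hP1

end Walks

section Product
variable {I V : Type*}

/-- The edge multiset of the product of two graphs with edge multisets `A` and `B`. -/
def prodEdges [Fintype I] [Fintype V] (A : Multiset (Sym2 I)) (B : Multiset (Sym2 V)) :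
    Multiset (Sym2 (I × V)) :=
  (Finset.univ : Finset I).val.bind (fun i => B.map (Sym2.map (Prod.mk i))) +
    (Finset.univ : Finset V).val.bind (fun v => A.map (Sym2.map (fun i => (i, v))))

lemma mem_bind_map_left [Fintype I] {B : Multiset (Sym2 V)} {i j : I} {v w : V} :
    s((i, v), (j, w)) ∈ (Finset.univ : Finset I).val.bind
      (fun i => B.map (Sym2.map (Prod.mk i))) ↔ s(v, w) ∈ B ∧ i = j := by
  simp only [Multiset.mem_bind, Finset.mem_val, Finset.mem_univ, true_and, Multiset.mem_map]
  constructor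
  · rintro ⟨k, e, he, h⟩
    induction e with | _ a b =>
    simp only [Sym2.map_mk, Sym2.eq_iff, Prod.mk.injEq] at h
    rcases h with ⟨⟨rfl, rfl⟩, rfl, rfl⟩ | ⟨⟨rfl, rfl⟩, rfl, rfl⟩
    · exact ⟨he, rfl⟩
    · exact ⟨by rwa [Sym2.eq_swap], rfl⟩
  · rintro ⟨h, rfl⟩
    exact ⟨i, _, h, rfl⟩

lemma mem_bind_map_right [Fintype V] {A : Multiset (Sym2 I)} {i j : I} {v w : V} :
    s((i, v), (j, w)) ∈ (Finset.univ : Finset V).val.bind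
      (fun v => A.map (Sym2.map (fun i => (i, v)))) ↔ s(i, j) ∈ A ∧ v = w := by
  simp only [Multiset.mem_bind, Finset.mem_val, Finset.mem_univ, true_and, Multiset.mem_map]
  constructor
  · rintro ⟨k, e, he, h⟩
    induction e with | _ a b =>
    simp only [Sym2.map_mk, Sym2.eq_iff, Prod.mk.injEq] at h
    rcases h with ⟨⟨rfl, rfl⟩, rfl, rfl⟩ | ⟨⟨rfl, rfl⟩, rfl, rfl⟩
    · exact ⟨he, rfl⟩
    · exact ⟨by rwa [Sym2.eq_swap], rfl⟩
  · rintro ⟨h, rfl⟩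
    exact ⟨v, _, h, rfl⟩

lemma mem_prodEdges [Fintype I] [Fintype V] {A : Multiset (Sym2 I)} {B : Multiset (Sym2 V)}
    {G : SimpleGraph I} {H : SimpleGraph V} (hA : ∀ e, e ∈ A ↔ e ∈ G.edgeSet)
    (hB : ∀ e, e ∈ B ↔ e ∈ H.edgeSet) (e : Sym2 (I × V)) : e ∈ prodEdges A B ↔ e ∈ (G □ H).edgeSet := by
  induction e with | _ x y =>
  obtain ⟨i, v⟩ := x
  obtain ⟨j, w⟩ := y
  rw [prodEdges, Multiset.mem_add, mem_bind_map_left, mem_bind_map_right, hA, hB,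
    mem_edgeSet, mem_edgeSet, mem_edgeSet, boxProd_adj]
  exact or_comm

lemma nodup_prodEdges [Fintype I] [Fintype V] {A : Multiset (Sym2 I)} {B : Multiset (Sym2 V)}
    (hA : A.Nodup) (hB : B.Nodup) (hd : ∀ e ∈ A, ¬ e.IsDiag) : (prodEdges A B).Nodup := by
  refine Multiset.nodup_add.2 ⟨?_, ?_, ?_⟩
  · refine Multiset.nodup_bind.2 ⟨fun i _ =>
      hB.map (Sym2.map.injective (Prod.mk_right_injective i)), ?_⟩
    refine Multiset.Nodup.pairwise ?_ Finset.univ.nodup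
    intro i _ j _ hij
    refine Multiset.disjoint_left.2 @fun e he he' => hij ?_
    obtain ⟨e₁, _, rfl⟩ := Multiset.mem_map.1 he
    obtain ⟨e₂, _, h⟩ := Multiset.mem_map.1 he'
    induction e₁ with | _ a b =>
    induction e₂ with | _ c d =>
    simp only [Sym2.map_mk, Sym2.eq_iff, Prod.mk.injEq] at h
    tauto
  · refine Multiset.nodup_bind.2 ⟨fun v _ =>
      hA.map (Sym2.map.injective (Prod.mk_left_injective v)), ?_⟩
    refine Multiset.Nodup.pairwise ?_ Finset.univ.nodup
    intro i _ j _ hij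
    refine Multiset.disjoint_left.2 @fun e he he' => hij ?_
    obtain ⟨e₁, _, rfl⟩ := Multiset.mem_map.1 he
    obtain ⟨e₂, _, h⟩ := Multiset.mem_map.1 he'
    induction e₁ with | _ a b =>
    induction e₂ with | _ c d =>
    simp only [Sym2.map_mk, Sym2.eq_iff, Prod.mk.injEq] at h
    tauto
  · refine Multiset.disjoint_left.2 @fun e he he' => ?_
    induction e with | _ x y =>
    obtain ⟨i, v⟩ := x
    obtain ⟨j, w⟩ := y
    rw [mem_bind_map_left] at he
    rw [mem_bind_map_right] at he'
    exact hd _ he'.1 (by simp [he.2])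

end Product

section PathGraph

lemma mem_pathEdges_iff {V : Type*} {l : List V} {e : Sym2 V} :
    e ∈ pathEdges l ↔ ∃ (k : ℕ) (h : k + 1 < l.length), e = s(l[k], l[k + 1]) := by
  induction l with
  | nil => simp
  | cons a l ih =>
    cases l with
    | nil => simp
    | cons b l =>
      rw [pathEdges_cons_cons, Multiset.mem_cons, ih]
      constructor
      · rintro (rfl | ⟨k, h, rfl⟩)
        · exact ⟨0, by simp, rfl⟩
        · exact ⟨k + 1, by simpa using h, rfl⟩
      · rintro ⟨_ | k, h, rfl⟩
        · exact Or.inl rfl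
        · exact Or.inr ⟨k, by simpa using h, rfl⟩

lemma mem_pathEdges_finRange {m : ℕ} {i j : Fin m} :
    s(i, j) ∈ pathEdges (List.finRange m) ↔ (pathGraph m).Adj i j := by
  rw [mem_pathEdges_iff, pathGraph_adj]
  simp only [List.length_finRange, List.getElem_finRange, Sym2.eq_iff, Fin.ext_iff, Fin.val_cast]
  constructor
  · rintro ⟨k, h, h' | h'⟩ <;> omega
  · rintro (h | h)
    · exact ⟨i, by omega, by omega⟩
    · exact ⟨j, by omega, by omega⟩

lemma finRange_eq {m : ℕ} (hm : 6 ≤ m) {a₀ c₀ x₀ z₀ : Fin m} (ha : (a₀ : ℕ) = 0) (hc : (c₀ : ℕ) = 2)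
    (hx : (x₀ : ℕ) = m - 3) (hz : (z₀ : ℕ) = m - 1) : ∃ (b y : Fin m) (pre : List (Fin m)),
    List.finRange m = a₀ :: b :: c₀ :: (pre ++ [x₀, y, z₀]) := by
  have hlen : (List.finRange m).length = m := List.length_finRange
  have hget : ∀ k : Fin m, (List.finRange m)[(k : ℕ)]? = some k := by simp
  generalize List.finRange m = l at hlen hget
  match l, hlen, hget with
  | a :: b :: c :: r, hlen, hget =>
    obtain ⟨r', rfl⟩ : ∃ r', r = r'.reverse := ⟨r.reverse, by simp⟩
    match r', hlen, hget with
    | z :: y :: x :: r, hlen, hget =>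
      simp only [List.length_cons, List.length_reverse] at hlen
      refine ⟨b, y, r.reverse, ?_⟩
      have h0 := hget a₀
      have h2 := hget c₀
      have h3 := hget x₀
      have h1 := hget z₀
      rw [ha] at h0
      rw [hc] at h2
      rw [hx, show m - 3 = r.length + 3 by omega] at h3
      rw [hz, show m - 1 = r.length + 2 + 3 by omega] at h1
      simp at h0 h1 h2 h3
      simp [h0, h1, h2, h3]
    | [], hlen, _ => simp at hlen; omega
    | [_], hlen, _ => simp at hlen; omega
    | [_, _], hlen, _ => simp at hlen; omega
  | [], hlen, _ => simp at hlen; omega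
  | [_], hlen, _ => simp at hlen; omega
  | [_, _], hlen, _ => simp at hlen; omega

end PathGraph

section Assembly
open scoped Classical

lemma Multiset.bind_val_eq_ite {V α : Type*} [Fintype V] (S : Finset V) (f : V → Multiset α) :
    S.val.bind f = (Finset.univ : Finset V).val.bind (fun v => if v ∈ S then f v else 0) := by
  have h : ∀ (T : Finset V) (g : V → Multiset α), T.val.bind g = ∑ v ∈ T, g v := fun _ _ => rfl
  rw [h, h, Finset.sum_ite_mem, Finset.univ_inter]

/-- The zigzag paths over an oriented decomposition of a graph cover all copies of that graph,
and some matchings in the fibres. -/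
lemma bind_pathEdges_zigzag {I V : Type*} [Fintype V] (l : List I) (M : Multiset (List V))
    (S L : Finset V) (hS : M.map List.head? = S.val.map some)
    (hL : M.map List.getLast? = L.val.map some) :
    (M.map (zigzag l)).bind pathEdges =
      (l : Multiset I).bind (fun i => (M.bind pathEdges).map (Sym2.map (Prod.mk i))) +
      (Finset.univ : Finset V).val.bind (fun v =>
        ((if v ∈ L then altEdges true l else 0) + (if v ∈ S then altEdges false l else 0)).map
          (Sym2.map (fun i => (i, v)))) := by
  let f : Bool → Option V → Multiset (Sym2 (I × V)) := fun b o =>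
    o.elim 0 (fun v => (altEdges b l).map (Sym2.map (fun i => (i, v))))
  have h1 : (M.map (zigzag l)).bind pathEdges = M.bind (fun P =>
      (l : Multiset I).bind (fun i => (pathEdges P).map (Sym2.map (Prod.mk i))) +
        (f true P.getLast? + f false P.head?)) := by
    rw [Multiset.bind_map]
    refine Multiset.bind_congr fun P hP => ?_
    have hh : P.head? ∈ S.val.map some := by rw [← hS]; exact Multiset.mem_map_of_mem _ hP
    have ht : P.getLast? ∈ L.val.map some := by rw [← hL]; exact Multiset.mem_map_of_mem _ hP
    obtain ⟨h, _, hh⟩ := Multiset.mem_map.1 hh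
    obtain ⟨t, _, ht⟩ := Multiset.mem_map.1 ht
    rw [pathEdges_zigzag l P h t hh.symm ht.symm, ← hh, ← ht]
    rfl
  have h2 : M.bind (fun P => f true P.getLast?) =
      L.val.bind (fun v => (altEdges true l).map (Sym2.map (fun i => (i, v)))) := by
    have := Multiset.bind_map M (f true) List.getLast?
    rw [← this, hL, Multiset.bind_map]
    rfl
  have h3 : M.bind (fun P => f false P.head?) =
      S.val.bind (fun v => (altEdges false l).map (Sym2.map (fun i => (i, v)))) := by
    have := Multiset.bind_map M (f false) List.head?
    rw [← this, hS, Multiset.bind_map]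
    rfl
  rw [h1, Multiset.bind_add, Multiset.bind_add, h2, h3, Multiset.bind_bind,
    Multiset.bind_val_eq_ite, Multiset.bind_val_eq_ite S, ← Multiset.bind_add]
  congr 1
  · simp only [Multiset.map_bind]
  · refine Multiset.bind_congr fun v _ => ?_
    rw [Multiset.map_add]
    congr 1 <;> split_ifs <;> simp

lemma exists_decomposition_prodEdges {m : ℕ} {V : Type*} [Fintype V] (a b c x y z : Fin m)
    (pre : List (Fin m)) (hl : List.finRange m = a :: b :: c :: (pre ++ [x, y, z]))
    (E : Multiset (Sym2 V)) (hE : E.Nodup) (hd : ∀ e ∈ E, ¬ e.IsDiag) :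
    ∃ M : Multiset (List (Fin m × V)), (∀ P ∈ M, P.Nodup) ∧
      M.bind pathEdges = prodEdges (pathEdges (List.finRange m) + {s(a, c), s(x, z)}) E ∧
      2 * M.card ≤ m * Fintype.card V := by
  obtain ⟨M, S, L, hM, hME, hS, hL, hSL⟩ := exists_oriented_decomposition E hE hd
  choose ex hex hexE hexc using fun v =>
    exists_fibre_paths a b c x y z pre _ hl (List.nodup_finRange m) (v ∈ S) (v ∈ L) (hSL v)
  refine ⟨M.map (zigzag (List.finRange m)) +
    (Finset.univ : Finset V).val.bind (fun v =>
      (ex v).map (List.map (fun i => (i, v)))), ?_, ?_, ?_⟩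
  · intro P hP
    rcases Multiset.mem_add.1 hP with hP | hP
    · obtain ⟨Q, hQ, rfl⟩ := Multiset.mem_map.1 hP
      exact nodup_zigzag (List.nodup_finRange m) (hM Q hQ)
    · obtain ⟨v, _, hP⟩ := Multiset.mem_bind.1 hP
      obtain ⟨Q, hQ, rfl⟩ := Multiset.mem_map.1 hP
      exact (hex v Q hQ).map (Prod.mk_left_injective v)
  · rw [Multiset.add_bind, bind_pathEdges_zigzag _ M S L hS hL, hME, Multiset.bind_assoc,
      add_assoc, ← Multiset.bind_add, prodEdges]
    congr 1
    refine Multiset.bind_congr fun v _ => ?_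
    rw [← hexE v, Multiset.map_add _ _ ((ex v).bind pathEdges), Multiset.bind_map,
      Multiset.map_bind]
    simp only [pathEdges_map]
  · have hcS : S.card = M.card := by simpa using (congrArg Multiset.card hS).symm
    have hcL : L.card = M.card := by simpa using (congrArg Multiset.card hL).symm
    have hsum : ∑ v : V, (2 * (ex v).card + ((if v ∈ S then 1 else 0) + (if v ∈ L then 1 else 0)))
        ≤ ∑ _v : V, m := Finset.sum_le_sum fun v _ => by
      simpa only [List.length_finRange] using hexc v
    simp only [Finset.sum_add_distrib, ← Finset.mul_sum, Finset.sum_boole, Finset.sum_const,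
      Finset.filter_univ_mem, Finset.card_univ, smul_eq_mul, Nat.cast_id, hcS, hcL] at hsum
    rw [Multiset.card_add, Multiset.card_map, Multiset.card_bind]
    simp only [Function.comp_def, Multiset.card_map]
    have : (Multiset.map (fun v => (ex v).card) (Finset.univ : Finset V).val).sum =
      ∑ v, (ex v).card := rfl
    rw [this, mul_comm m]
    omega

end Assembly

/-- Gallai's bound for the product of a member of the family `𝒢`
(path `u₁⋯u_m` plus edges `u₁u₃` and `u_{m-2}u_m`) with a connected graph `H`. -/
theorem pathNumber_familyG_boxProd_le {W : Type*} [Fintype W] (m : ℕ) (hm : 6 ≤ m)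
    (H : SimpleGraph W) (hH : H.Connected) :
    2 * ((pathGraph m ⊔ fromEdgeSet
        {s((⟨0, by omega⟩ : Fin m), (⟨2, by omega⟩ : Fin m)),
         s((⟨m - 3, by omega⟩ : Fin m), (⟨m - 1, by omega⟩ : Fin m))}) □ H).pathNumber ≤
      m * Fintype.card W := by
  classical
  obtain ⟨b, y, pre, hl⟩ := finRange_eq hm (a₀ := ⟨0, by omega⟩) (c₀ := ⟨2, by omega⟩)
    (x₀ := ⟨m - 3, by omega⟩) (z₀ := ⟨m - 1, by omega⟩) rfl rfl rfl rfl
  obtain ⟨M, hM, hME, hMc⟩ := exists_decomposition_prodEdges _ b _ _ y _ pre hl H.edgeFinset.val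
    H.edgeFinset.nodup (fun e he => H.not_isDiag_of_mem_edgeSet (mem_edgeFinset.1 he))
  refine le_trans (Nat.mul_le_mul_left 2 (pathNumber_le_card _ M hM ?_ ?_)) hMc
  · rw [hME]
    refine nodup_prodEdges ?_ H.edgeFinset.nodup ?_
    · refine Multiset.nodup_add.2 ⟨nodup_pathEdges (List.nodup_finRange m), ?_, ?_⟩
      · simp [Fin.ext_iff]
        omega
      · refine Multiset.disjoint_right.2 @fun e he he' => ?_
        simp only [Multiset.insert_eq_cons, Multiset.mem_cons, Multiset.mem_singleton] at he
        rcases he with rfl | rfl <;> rw [mem_pathEdges_finRange, pathGraph_adj] at he' <;>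
          simp only at he' <;> omega
    · intro e he
      rcases Multiset.mem_add.1 he with he | he
      · exact not_isDiag_of_mem_pathEdges (List.nodup_finRange m) he
      · simp only [Multiset.insert_eq_cons, Multiset.mem_cons, Multiset.mem_singleton] at he
        rcases he with rfl | rfl <;> simp
        omega
  · rw [hME]
    refine mem_prodEdges ?_ (fun e => mem_edgeFinset)
    intro e
    induction e with | _ i j =>
    simp only [Multiset.mem_add, mem_pathEdges_finRange, Multiset.insert_eq_cons,
      Multiset.mem_cons, Multiset.mem_singleton, mem_edgeSet, sup_adj, fromEdgeSet_adj,
      Set.mem_insert_iff, Set.mem_singleton_iff]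
    refine or_congr_right (and_iff_left_of_imp ?_).symm
    rintro h rfl
    simp only [Sym2.eq_iff, Fin.ext_iff] at h
    omega
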